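/- arXiv:math/0403136 — 3 statements merged into one kernel-verified Lean document; each statement's English description precedes it below -/
import Mathlib

section
/- Let V be a finite-dimensional real vector space, W ⊆ V a subspace, and π : V* → V a skew-symmetric linear map that is horizontally non-degenerate with respect to W. Set H := π(W⁰), let p : V → V be the projection onto H along W and q := id_V − p the projection onto W along H. Then for all α, β ∈ V* one has α(π(β)) = (α∘p)(π(β∘p)) + (α∘q)(π(β∘q)); in other words the mixed components vanish and the bivector decomposes as Π = Π_H + 𝒱 with Π_H ∈ Λ²H and 𝒱 ∈ Λ²W. -/
/-- A linear map `π : V* → V` is skew-symmetric if `α (π β) = - β (π α)` for all `α β`. -/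
def IsSkewSymm {V : Type*} [AddCommGroup V] [Module ℝ V]
    (π : Module.Dual ℝ V →ₗ[ℝ] V) : Prop :=
  ∀ α β : Module.Dual ℝ V, α (π β) = - β (π α)

/-- `π` is horizontally non-degenerate w.r.t. the subspace `W`:
`π(W⁰) ∩ W = {0}` and `dim π(W⁰) = dim V - dim W`. -/
def IsHorizNondeg {V : Type*} [AddCommGroup V] [Module ℝ V]
    (W : Submodule ℝ V) (π : Module.Dual ℝ V →ₗ[ℝ] V) : Prop :=
  (W.dualAnnihilator.map π) ⊓ W = ⊥ ∧
    Module.finrank ℝ (W.dualAnnihilator.map π) =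
      Module.finrank ℝ V - Module.finrank ℝ W

/-- with `p` the projection onto `H = π(W⁰)` along `W` and `q = id - p`,
`α (π β) = (α∘p)(π(β∘p)) + (α∘q)(π(β∘q))` for all `α β`, i.e. `Π = Π_H + 𝒱`. -/
theorem bivector_decomposition
    {V : Type*} [AddCommGroup V] [Module ℝ V] [FiniteDimensional ℝ V]
    (W : Submodule ℝ V) (π : Module.Dual ℝ V →ₗ[ℝ] V)
    (hskew : IsSkewSymm π) (hnd : IsHorizNondeg W π)
    (p : V →ₗ[ℝ] V)
    (hpH : ∀ x : V, p x ∈ W.dualAnnihilator.map π)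
    (hpW : ∀ x : V, x - p x ∈ W)
    (q : V →ₗ[ℝ] V) (hq : q = LinearMap.id - p) :
    ∀ α β : Module.Dual ℝ V,
      α (π β) = α (p (π (β ∘ₗ p))) + α (q (π (β ∘ₗ q))) := by
  intro α β
  subst hq
  have eq_zero : ∀ x ∈ W.dualAnnihilator.map π, x ∈ W → x = 0 := fun x hH hW =>
    (Submodule.mem_bot ℝ).1 (hnd.1 ▸ Submodule.mem_inf.2 ⟨hH, hW⟩)
  have p_of_mem_W : ∀ w ∈ W, p w = 0 := fun w hw =>
    eq_zero _ (hpH w) (by simpa using W.sub_mem hw (hpW w))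
  have p_of_mem_H : ∀ x ∈ W.dualAnnihilator.map π, p x = x := fun x hx =>
    (sub_eq_zero.1 (eq_zero _ (Submodule.sub_mem _ hx (hpH x)) (hpW x))).symm
  have π_mem_H : ∀ γ : Module.Dual ℝ V, π (γ ∘ₗ p) ∈ W.dualAnnihilator.map π := fun γ =>
    Submodule.mem_map_of_mem ((Submodule.mem_dualAnnihilator _).2 fun w hw => by
      simp [p_of_mem_W w hw])
  have mixed_eq_zero : α (p (π (β ∘ₗ (LinearMap.id - p)))) = 0 := by
    have h := hskew (α ∘ₗ p) (β ∘ₗ (LinearMap.id - p))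
    simpa [p_of_mem_H _ (π_mem_H α)] using h
  have split : β = β ∘ₗ p + β ∘ₗ (LinearMap.id - p) := by
    ext x
    simp
  rw [p_of_mem_H _ (π_mem_H β), LinearMap.sub_apply, LinearMap.id_apply, map_sub,
    mixed_eq_zero, sub_zero, ← map_add, ← map_add, ← split]
end

section
/- Let V be a finite-dimensional real vector space and W ⊆ V a subspace. Suppose given: a subspace H ⊆ V complementary to W (H ∩ W = {0}, H + W = V); a skew-symmetric linear map v : V* → V with v(W⁰) = {0} and image contained in W; and a non-degenerate alternating bilinear form G₀ on H. Then there exists a unique skew-symmetric linear map π : V* → V that is horizontally non-degenerate with respect to W and satisfies: (i) π(W⁰) = H; (ii) π(α) = v(α) for all α ∈ H⁰; and (iii) the induced form G(u, v) := −(Φ⁻¹(u))(v) on H, where Φ : W⁰ → H is the isomorphism induced by π, equals G₀. -/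
/-- pointwise version of Vorobjev's Proposition 1: geometric data
`(H, v, G₀)` determine a unique horizontally non-degenerate skew-symmetric `π`.
Condition (iii) is expressed by: for every `α ∈ W⁰`, `Φ α = π α ∈ H` and
`G₀ (π α) u' = -(α u')`, i.e. the form induced by `π` is `G₀`. -/
theorem geometric_data_equiv_bivector
    {V : Type*} [AddCommGroup V] [Module ℝ V] [FiniteDimensional ℝ V]
    (W H : Submodule ℝ V) (hcompl : H ⊓ W = ⊥ ∧ H ⊔ W = ⊤)
    (v : Module.Dual ℝ V →ₗ[ℝ] V) (hvskew : IsSkewSymm v)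
    (hv0 : W.dualAnnihilator.map v = ⊥) (hvW : LinearMap.range v ≤ W)
    (G₀ : H →ₗ[ℝ] H →ₗ[ℝ] ℝ)
    (hG₀alt : ∀ u u' : H, G₀ u u' = - G₀ u' u)
    (hG₀nd : ∀ u : H, (∀ u' : H, G₀ u u' = 0) → u = 0) :
    ∃! π : Module.Dual ℝ V →ₗ[ℝ] V,
      IsSkewSymm π ∧ IsHorizNondeg W π ∧
      W.dualAnnihilator.map π = H ∧
      (∀ α ∈ H.dualAnnihilator, π α = v α) ∧
      (∀ α ∈ W.dualAnnihilator, ∀ h : π α ∈ H, ∀ u' : H,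
        G₀ ⟨π α, h⟩ u' = - (α (u' : V))) := by
  have hc : IsCompl H W := IsCompl.of_eq hcompl.1 hcompl.2
  have hinj : Function.Injective G₀ := by
    refine (injective_iff_map_eq_zero G₀).2 fun u hu => hG₀nd u fun u' => ?_
    simp [hu]
  let e : H ≃ₗ[ℝ] Module.Dual ℝ H :=
    LinearEquiv.ofInjectiveOfFinrankEq G₀ hinj Subspace.dual_finrank_eq.symm
  have he : ∀ f u, G₀ (e.symm f) u = f u := fun f u =>
    LinearMap.congr_fun (e.apply_symm_apply f) u
  have hvanish : ∀ α ∈ W.dualAnnihilator, v α = 0 := fun α hα => by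
    simpa [hv0] using Submodule.mem_map_of_mem (f := v) hα
  let P : V →ₗ[ℝ] H := H.projectionOnto W hc
  have hPW : ∀ f : Module.Dual ℝ H, f ∘ₗ P ∈ W.dualAnnihilator := fun f => by
    rw [Submodule.mem_dualAnnihilator]
    intro w hw
    simp [P, (Submodule.projectionOnto_apply_eq_zero_iff hc).2 hw]
  have hPH : ∀ u : H, P u = u := Submodule.projectionOnto_apply_left hc
  let ρ : Module.Dual ℝ V →ₗ[ℝ] H := -(e.symm.toLinearMap ∘ₗ H.subtype.dualMap)
  have hρ : ∀ α u, G₀ (ρ α) u = -α u := fun α u => by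
    simp [ρ, he]
  have hmap : W.dualAnnihilator.map (v + H.subtype ∘ₗ ρ) = H := by
    apply le_antisymm
    · rintro _ ⟨α, hα, rfl⟩
      simp [hvanish α hα]
    · intro u hu
      refine ⟨-(G₀ ⟨u, hu⟩ ∘ₗ P), neg_mem (hPW _), ?_⟩
      have : ρ (-(G₀ ⟨u, hu⟩ ∘ₗ P)) = ⟨u, hu⟩ := hinj <| LinearMap.ext fun u' => by
        rw [hρ]
        simp [hPH]
      rw [LinearMap.add_apply, hvanish _ (neg_mem (hPW _)), LinearMap.comp_apply, this]
      simp
  refine ⟨v + H.subtype ∘ₗ ρ, ⟨?_, ⟨?_, ?_⟩, hmap, ?_, ?_⟩, ?_⟩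
  · intro α β
    have h := hG₀alt (ρ α) (ρ β)
    rw [hρ, hρ] at h
    have h' := hvskew α β
    simp only [LinearMap.add_apply, LinearMap.comp_apply, Submodule.subtype_apply, map_add]
    linarith
  · rw [hmap, hcompl.1]
  · rw [hmap, ← Submodule.finrank_add_eq_of_isCompl hc, Nat.add_sub_cancel]
  · intro α hα
    have : ρ α = 0 := hG₀nd _ fun u' => by
      rw [hρ, (Submodule.mem_dualAnnihilator α).1 hα u' u'.2, neg_zero]
    simp [this]
  · intro α hα h u'
    have : (⟨(v + H.subtype ∘ₗ ρ) α, h⟩ : H) = ρ α := Subtype.ext (by simp [hvanish α hα])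
    rw [this, hρ]
  · rintro π ⟨-, -, hπH, hπv, hπG⟩
    have hW : ∀ α ∈ W.dualAnnihilator, π α = ρ α := fun α hα => by
      have h : π α ∈ H := hπH.le (Submodule.mem_map_of_mem hα)
      have : (⟨π α, h⟩ : H) = ρ α := hinj <| LinearMap.ext fun u' => by
        rw [hπG α hα h u', hρ]
      exact congrArg Subtype.val this
    ext1 α
    let β : Module.Dual ℝ V := (α ∘ₗ H.subtype) ∘ₗ P
    have hβ : β ∈ W.dualAnnihilator := hPW _
    have hγ : α - β ∈ H.dualAnnihilator := by
      rw [Submodule.mem_dualAnnihilator]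
      intro u hu
      simp [β, hPH ⟨u, hu⟩]
    have hργ : ρ (α - β) = 0 := hG₀nd _ fun u' => by
      rw [hρ, (Submodule.mem_dualAnnihilator _).1 hγ u' u'.2, neg_zero]
    have hρβ : ρ α = ρ β := by rwa [map_sub, sub_eq_zero] at hργ
    calc π α = π (α - β) + π β := by rw [← map_add, sub_add_cancel]
      _ = v (α - β) + ρ β := by rw [hπv _ hγ, hW β hβ]
      _ = (v + H.subtype ∘ₗ ρ) α := by simp [hvanish β hβ, hρβ]
end

section
/- Let E and F be real normed vector spaces and f : E → F a map that is differentiable at every point, with Fréchet derivative Df(y) at y. If Df(y)(y) = f(y) for every y ∈ E, then f is linear: f(y) = Df(0)(y) for all y ∈ E, where Df(0) is the (continuous linear) derivative of f at 0. -/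
open Set Filter Topology in
/-- A differentiable map satisfying the Euler relation is positively homogeneous of degree one. -/
theorem map_smul_of_fderiv_apply_self
    {E F : Type*} [NormedAddCommGroup E] [NormedSpace ℝ E]
    [NormedAddCommGroup F] [NormedSpace ℝ F]
    {f : E → F} (hdiff : Differentiable ℝ f) (heuler : ∀ y : E, fderiv ℝ f y y = f y)
    {t : ℝ} (ht : 0 < t) (y : E) : f (t • y) = t • f y := by
  have hderiv : ∀ s ∈ Ioi (0 : ℝ), HasDerivAt (fun r : ℝ => r⁻¹ • f (r • y)) 0 s := by
    intro s hs
    have hs0 : s ≠ 0 := ne_of_gt hs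
    have hray : HasDerivAt (fun r : ℝ => f (r • y)) (fderiv ℝ f (s • y) y) s := by
      have hline : HasDerivAt (fun r : ℝ => r • y) y s := by
        simpa using (hasDerivAt_id s).smul_const y
      exact (hdiff (s • y)).hasFDerivAt.comp_hasDerivAt s hline
    refine ((hasDerivAt_inv hs0).smul hray).congr_deriv ?_
    rw [← heuler (s • y), map_smul, smul_smul, ← add_smul]
    have hcoeff : s⁻¹ + -(s ^ 2)⁻¹ * s = 0 := by field_simp; ring
    rw [hcoeff, zero_smul]
  have hconst := isOpen_Ioi.is_const_of_deriv_eq_zero isPreconnected_Ioi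
    (fun s hs => (hderiv s hs).differentiableAt.differentiableWithinAt)
    (fun s hs => (hderiv s hs).deriv) (mem_Ioi.2 ht) (mem_Ioi.2 one_pos)
  simp only [inv_one, one_smul] at hconst
  rw [← hconst, smul_inv_smul₀ ht.ne']

open Filter in
/-- if `Df(y)(y) = f(y)` everywhere, then `f` is linear:
`f(y) = Df(0)(y)` for all `y`. -/
theorem euler_relation_implies_linear
    {E F : Type*} [NormedAddCommGroup E] [NormedSpace ℝ E]
    [NormedAddCommGroup F] [NormedSpace ℝ F]
    (f : E → F) (hdiff : Differentiable ℝ f)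
    (heuler : ∀ y : E, fderiv ℝ f y y = f y) :
    ∀ y : E, f y = fderiv ℝ f 0 y := by
  intro y
  have hzero : f 0 = 0 := by simpa using (heuler 0).symm
  have hlim := (hdiff 0).hasFDerivAt.lim y (c := fun r : ℝ => r) tendsto_norm_atTop_atTop
  refine tendsto_nhds_unique (tendsto_const_nhds.congr' ?_) hlim
  filter_upwards [eventually_gt_atTop 0] with r hr
  rw [zero_add, hzero, sub_zero, map_smul_of_fderiv_apply_self hdiff heuler (inv_pos.2 hr),
    smul_inv_smul₀ hr.ne']
end
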